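/- For any fixed Ω ≥ 0, the infimum e(a) tends to −∞ as a increases to a* = ‖Q‖_{L²}², i.e. lim_{a↗a*} e(a) = −∞. -/

import Mathlib

open MeasureTheory Filter Topology Set Metric

noncomputable section

/-- The plane `ℝ²` with the Euclidean norm. -/
abbrev Plane : Type := EuclideanSpace ℝ (Fin 2)

def e0 : Plane := EuclideanSpace.single (0 : Fin 2) (1 : ℝ)
def e1 : Plane := EuclideanSpace.single (1 : Fin 2) (1 : ℝ)

/-- Partial derivatives of a complex-valued function. -/
def d0 (u : Plane → ℂ) (x : Plane) : ℂ := fderiv ℝ u x e0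
def d1 (u : Plane → ℂ) (x : Plane) : ℂ := fderiv ℝ u x e1

/-- `|∇u|²` for complex-valued `u`. -/
def gradSq (u : Plane → ℂ) (x : Plane) : ℝ := ‖d0 u x‖ ^ 2 + ‖d1 u x‖ ^ 2

/-- `|∇|u||²`. -/
def gradAbsSq (u : Plane → ℂ) (x : Plane) : ℝ := ‖fderiv ℝ (fun y => ‖u y‖) x‖ ^ 2

/-- Membership in `H¹(ℝ², ℂ)` (smooth-representative formulation). -/
def InH1 (u : Plane → ℂ) : Prop :=
  Differentiable ℝ u ∧ Integrable (fun x => ‖u x‖ ^ 2) ∧ Integrable (gradSq u)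

/-- Membership in the space `𝓗 = {u ∈ H¹ : ∫ V |u|² < ∞}`. -/
def InH (V : Plane → ℝ) (u : Plane → ℂ) : Prop :=
  InH1 u ∧ Integrable (fun x => V x * ‖u x‖ ^ 2)

/-- The constraint set `S_a`. -/
def Sset (V : Plane → ℝ) (a : ℝ) : Set (Plane → ℂ) :=
  {u | InH V u ∧ (∫ x : Plane, ‖u x‖ ^ 2) = a}

/-- The momentum density `x^⊥ · (iu, ∇u)`, with `x^⊥ = (-x₂, x₁)` and
`(iu,∇u)_j = Im(ū ∂_j u)`. -/
def momentum (u : Plane → ℂ) (x : Plane) : ℝ :=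
  (-(x 1)) * ((starRingEnd ℂ) (u x) * d0 u x).im + (x 0) * ((starRingEnd ℂ) (u x) * d1 u x).im

/-- The logarithmic convolution term `∫∫ ln|x-y| |u(x)|²|u(y)|²`. -/
def logConv (u : Plane → ℂ) : ℝ :=
  ∫ x : Plane, ∫ y : Plane, Real.log ‖x - y‖ * ‖u x‖ ^ 2 * ‖u y‖ ^ 2

/-- The energy functional `E_a`. -/
def Ea (V : Plane → ℝ) (Ω : ℝ) (u : Plane → ℂ) : ℝ :=
  (∫ x : Plane, (gradSq u x + V x * ‖u x‖ ^ 2)) + (1 / 2) * logConv u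
    - (1 / 2) * (∫ x : Plane, ‖u x‖ ^ 4) - Ω * (∫ x : Plane, momentum u x)

/-- `u` is a minimizer of `e(a) = inf_{S_a} E_a`. -/
def IsMinimizer (V : Plane → ℝ) (Ω a : ℝ) (u : Plane → ℂ) : Prop :=
  u ∈ Sset V a ∧ ∀ v ∈ Sset V a, Ea V Ω u ≤ Ea V Ω v

/-- `e(a) = inf_{u ∈ S_a} E_a(u)`. -/
def eInf (V : Plane → ℝ) (Ω a : ℝ) : ℝ := sInf (Ea V Ω '' Sset V a)

/-- `f(x) → ∞` as `|x| → ∞`. -/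
def TendsInfty (f : Plane → ℝ) : Prop := ∀ M : ℝ, ∃ R : ℝ, ∀ x : Plane, R ≤ ‖x‖ → M ≤ f x

/-- Hypotheses (1.10): `0 ≤ V ∈ L^∞_loc` and `liminf_{|x|→∞} V(x)/|x|² > 0`. -/
def V110 (V : Plane → ℝ) : Prop :=
  Measurable V ∧ (∀ x, 0 ≤ V x) ∧
  (∀ R : ℝ, ∃ C : ℝ, ∀ x : Plane, ‖x‖ ≤ R → V x ≤ C) ∧
  (∃ c : ℝ, 0 < c ∧ ∃ R : ℝ, ∀ x : Plane, R ≤ ‖x‖ → c * ‖x‖ ^ 2 ≤ V x)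

/-- The set of rotational velocities `W > 0` with `V(x) - (W²/4)|x|² → ∞`;
`Ω* = sup RotSet V`. -/
def RotSet (V : Plane → ℝ) : Set ℝ :=
  {W : ℝ | 0 < W ∧ TendsInfty (fun x => V x - W ^ 2 / 4 * ‖x‖ ^ 2)}

/-- `Ω < Ω*` where `Ω* = sup RotSet V` (possibly `+∞`). -/
def SubCritical (V : Plane → ℝ) (Ω : ℝ) : Prop := ∃ W ∈ RotSet V, Ω < W

def d0R (q : Plane → ℝ) (x : Plane) : ℝ := fderiv ℝ q x e0
def d1R (q : Plane → ℝ) (x : Plane) : ℝ := fderiv ℝ q x e1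

/-- `|∇q|²` for real-valued `q`. -/
def gradSqR (q : Plane → ℝ) (x : Plane) : ℝ := (d0R q x) ^ 2 + (d1R q x) ^ 2

/-- The Laplacian of a real-valued function. -/
def lapR (q : Plane → ℝ) (x : Plane) : ℝ := fderiv ℝ (d0R q) x e0 + fderiv ℝ (d1R q) x e1

/-- `Q` is the positive radially symmetric `H¹` solution of `-ΔQ + Q - Q³ = 0` on `ℝ²`. -/
def IsGroundState (Q : Plane → ℝ) : Prop :=
  ContDiff ℝ 2 Q ∧ (∀ x, 0 < Q x) ∧ (∀ x y : Plane, ‖x‖ = ‖y‖ → Q x = Q y) ∧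
  Integrable (fun x => (Q x) ^ 2) ∧ Integrable (fun x => ‖fderiv ℝ Q x‖ ^ 2) ∧
  (∀ x, - lapR Q x + Q x - (Q x) ^ 3 = 0)

/-- The Laplacian of a complex-valued function. -/
def lapC (u : Plane → ℂ) (x : Plane) : ℂ := fderiv ℝ (d0 u) x e0 + fderiv ℝ (d1 u) x e1

/-- The Euler–Lagrange equation (1.18):
`-Δu + V u + (∫ ln|x-y||u(y)|² dy) u + iΩ (x^⊥·∇u) = μ u + |u|² u`. -/
def EulerLagrange (V : Plane → ℝ) (Ω : ℝ) (u : Plane → ℂ) (μ : ℝ) : Prop :=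
  ∀ x : Plane,
    - lapC u x + (V x : ℂ) * u x
      + (((∫ y : Plane, Real.log ‖x - y‖ * ‖u y‖ ^ 2) : ℝ) : ℂ) * u x
      + Complex.I * (Ω : ℂ) * (((-(x 1) : ℝ) : ℂ) * d0 u x + ((x 0 : ℝ) : ℂ) * d1 u x)
    = (μ : ℂ) * u x + ((‖u x‖ ^ 2 : ℝ) : ℂ) * u x

/-- Condition (V): `0 ≤ V_Ω ∈ C^α_loc`, `V_Ω` vanishes only at the origin, and `V` has at
most exponential growth. Here `V_Ω(x) = V(x) - (Ω²/4)|x|²`. -/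
def CondV (V : Plane → ℝ) (Ω α : ℝ) : Prop :=
  α ∈ Ioo (0 : ℝ) 1 ∧
  (∀ x : Plane, 0 ≤ V x - Ω ^ 2 / 4 * ‖x‖ ^ 2) ∧
  (∀ x : Plane, V x - Ω ^ 2 / 4 * ‖x‖ ^ 2 = 0 ↔ x = 0) ∧
  (∀ R : ℝ, 0 < R → ∃ C : ℝ, ∀ x ∈ closedBall (0 : Plane) R, ∀ y ∈ closedBall (0 : Plane) R,
    |(V x - Ω ^ 2 / 4 * ‖x‖ ^ 2) - (V y - Ω ^ 2 / 4 * ‖y‖ ^ 2)| ≤ C * ‖x - y‖ ^ α) ∧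
  (∃ C γ : ℝ, 0 < γ ∧ ∀ x : Plane, V x ≤ C * Real.exp (γ * ‖x‖))

/-- `ε_a = (∫ |∇|u_a||²)^{-1/2}` for a family of minimizers. -/
def epsOf (u : ℝ → Plane → ℂ) (a : ℝ) : ℝ :=
  (∫ x : Plane, gradAbsSq (u a) x) ^ (-(1 : ℝ) / 2)

/-- The rescaled family
`w_a(y) = ε_a u_a(ε_a y + x_a) e^{-i((ε_a Ω/2) y·x_a^⊥ - θ)}`. -/
def wfam (Ω : ℝ) (u : ℝ → Plane → ℂ) (xa : ℝ → Plane) (a θv : ℝ) (y : Plane) : ℂ :=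
  ((epsOf u a : ℝ) : ℂ) * u a ((epsOf u a) • y + xa a) *
    Complex.exp (-Complex.I *
      ((((epsOf u a * Ω / 2) * (-(y 0) * (xa a 1) + (y 1) * (xa a 0)) - θv) : ℝ) : ℂ))

/-- The limit profile `(1/√a*) Q(x/√a*)` where `a* = ‖Q‖₂²`. -/
def Qstar (Q : Plane → ℝ) (x : Plane) : ℝ :=
  (Real.sqrt (∫ y : Plane, (Q y) ^ 2))⁻¹ * Q ((Real.sqrt (∫ y : Plane, (Q y) ^ 2))⁻¹ • x)

theorem decay_of_radial_ode {q p : ℝ → ℝ} (hq : ∀ r, HasDerivAt q (p r) r)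
    (hp : ∀ r, 0 < r → HasDerivAt p (q r - q r ^ 3 - p r / r) r) (hpos : ∀ r, 0 < q r)
    (hq2 : IntegrableOn (fun r => r * q r ^ 2) (Ioi 0))
    (hp2 : IntegrableOn (fun r => r * p r ^ 2) (Ioi 0)) :
    ∃ C R₀ : ℝ, 0 < C ∧ 1 ≤ R₀ ∧ ∀ r, R₀ ≤ r →
      q r ≤ C * Real.exp (-(r / 2)) ∧ |p r| ≤ C * Real.exp (-(r / 2)) := by
  have hqc : Continuous q := continuous_iff_continuousAt.2 fun r => (hq r).continuousAt
  have hpc : ContinuousOn p (Ioi 0) := fun r hr => (hp r hr).continuousAt.continuousWithinAt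
  have sub : Ioi (1 : ℝ) ⊆ Ioi 0 := Ioi_subset_Ioi zero_le_one
  have iq : IntegrableOn (fun r => q r ^ 2) (Ioi 1) := by
    refine Integrable.mono (hq2.mono_set sub) (by fun_prop) ?_
    filter_upwards [ae_restrict_mem measurableSet_Ioi] with r hr
    have hr : 1 < r := hr
    rw [Real.norm_of_nonneg (by positivity), Real.norm_of_nonneg (by positivity)]
    nlinarith [sq_nonneg (q r)]
  have ip : IntegrableOn (fun r => p r ^ 2) (Ioi 1) := by
    refine Integrable.mono (hp2.mono_set sub)
      (((hpc.mono sub).pow 2).aestronglyMeasurable measurableSet_Ioi) ?_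
    filter_upwards [ae_restrict_mem measurableSet_Ioi] with r hr
    have hr : 1 < r := hr
    rw [Real.norm_of_nonneg (by positivity), Real.norm_of_nonneg (by positivity)]
    nlinarith [sq_nonneg (p r)]
  have tq2 : Tendsto (fun r => q r ^ 2) atTop (𝓝 0) := by
    refine tendsto_zero_of_hasDerivAt_of_integrableOn_Ioi (a := 1) (f' := fun r => 2 * q r * p r)
      (fun r _ => ((hq r).pow 2).congr_deriv (by simp)) ?_ iq
    refine Integrable.mono (iq.add ip) (((continuous_const.mul hqc).continuousOn.mul
      (hpc.mono sub)).aestronglyMeasurable measurableSet_Ioi) ?_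
    refine Eventually.of_forall fun r => ?_
    simp only [Pi.add_apply]
    rw [Real.norm_eq_abs, Real.norm_of_nonneg (by positivity), abs_le]
    constructor <;> nlinarith [sq_nonneg (q r + p r), sq_nonneg (q r - p r)]
  have tq : Tendsto q atTop (𝓝 0) := by
    have := tq2.sqrt
    simpa [Real.sqrt_sq (hpos _).le] using this
  obtain ⟨R₁, hR₁⟩ : ∃ R₁, ∀ r, R₁ ≤ r → q r < 1 / 2 :=
    eventually_atTop.1 (tq.eventually_lt_const (by norm_num))
  set R := max R₁ 1 with hR
  have hR1 : 1 ≤ R := le_max_right _ _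
  have hqs : ∀ r, R ≤ r → q r < 1 / 2 := fun r hr => hR₁ r ((le_max_left _ _).trans hr)
  have subR : Ioi R ⊆ Ioi 1 := Ioi_subset_Ioi hR1
  -- the mechanical energy decreases to zero
  have dH : ∀ r, 0 < r → HasDerivAt (fun r => p r ^ 2 + q r ^ 4 / 2 - q r ^ 2)
      (-(2 * p r ^ 2 / r)) r := by
    intro r hr
    have := (((hp r hr).pow 2).add (((hq r).pow 4).div_const 2)).sub ((hq r).pow 2)
    refine this.congr_deriv ?_
    simp; field_simp; ring
  have iH : IntegrableOn (fun r => p r ^ 2 + q r ^ 4 / 2 - q r ^ 2) (Ioi R) := by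
    refine ((ip.mono_set subR).add ?_).sub (iq.mono_set subR)
    refine Integrable.mono (iq.mono_set subR) (by fun_prop) ?_
    filter_upwards [ae_restrict_mem measurableSet_Ioi] with r hr
    have h1 := hqs r (le_of_lt hr)
    have h2 := hpos r
    rw [Real.norm_of_nonneg (by positivity), Real.norm_of_nonneg (by positivity)]
    have : q r ^ 4 = q r ^ 2 * q r ^ 2 := by ring
    have h3 : q r ^ 2 ≤ 1 := by nlinarith
    nlinarith [sq_nonneg (q r)]
  have tH : Tendsto (fun r => p r ^ 2 + q r ^ 4 / 2 - q r ^ 2) atTop (𝓝 0) := by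
    refine tendsto_zero_of_hasDerivAt_of_integrableOn_Ioi (a := R)
      (f' := fun r => -(2 * p r ^ 2 / r))
      (fun r hr => dH r (by have : R < r := hr; linarith)) ?_ iH
    refine Integrable.mono ((ip.mono_set subR).const_mul 2) ?_ ?_
    · refine ContinuousOn.aestronglyMeasurable ?_ measurableSet_Ioi
      have : ContinuousOn p (Ioi R) := hpc.mono (subR.trans sub)
      refine ((continuousOn_const.mul (this.pow 2)).div continuousOn_id ?_).neg
      intro r hr
      have : R < r := hr
      simp; linarith
    · filter_upwards [ae_restrict_mem measurableSet_Ioi] with r hr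
      have hr : R < r := hr
      have : 1 ≤ r := by linarith
      rw [norm_neg, Real.norm_of_nonneg (by positivity), Real.norm_of_nonneg (by positivity)]
      exact div_le_self (by positivity) this
  have Hanti : AntitoneOn (fun r => p r ^ 2 + q r ^ 4 / 2 - q r ^ 2) (Ici 1) := by
    refine antitoneOn_of_hasDerivWithinAt_nonpos (convex_Ici 1)
      (f' := fun r => -(2 * p r ^ 2 / r)) ?_ ?_ ?_
    · intro r hr
      have hr : 1 ≤ r := hr
      exact (dH r (by linarith)).continuousAt.continuousWithinAt
    · intro r hr
      rw [interior_Ici] at hr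
      exact (dH r (sub hr)).hasDerivWithinAt
    · intro r hr
      rw [interior_Ici] at hr
      have : 0 < r := sub hr
      have : 0 ≤ 2 * p r ^ 2 / r := by positivity
      linarith
  have Hnn : ∀ r, 1 ≤ r → 0 ≤ p r ^ 2 + q r ^ 4 / 2 - q r ^ 2 := by
    intro r hr
    refine le_of_tendsto tH ?_
    filter_upwards [eventually_ge_atTop r] with s hs
    exact Hanti hr (hr.trans hs) hs
  -- monotonicity of the flux
  have drp : ∀ r, 0 < r → HasDerivAt (fun r => r * p r) (r * (q r - q r ^ 3)) r := by
    intro r hr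
    refine ((hasDerivAt_id r).mul (hp r hr)).congr_deriv ?_
    simp; field_simp; ring
  have rpmono : MonotoneOn (fun r => r * p r) (Ici R) := by
    refine monotoneOn_of_hasDerivWithinAt_nonneg (convex_Ici R)
      (f' := fun r => r * (q r - q r ^ 3)) ?_ ?_ ?_
    · intro r hr
      have hr : R ≤ r := hr
      exact (drp r (by linarith)).continuousAt.continuousWithinAt
    · intro r hr
      rw [interior_Ici] at hr
      exact (drp r (sub (subR hr))).hasDerivWithinAt
    · intro r hr
      rw [interior_Ici] at hr
      have h0 : 0 < r := sub (subR hr)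
      have h1 := hqs r (le_of_lt hr)
      have h2 := hpos r
      refine mul_nonneg h0.le ?_
      have : q r ^ 2 ≤ 1 := by nlinarith
      nlinarith
  have pneg : ∀ r, R ≤ r → p r ≤ 0 := by
    intro r hr
    by_contra! hlt
    have hmon : MonotoneOn q (Ici r) := by
      refine monotoneOn_of_hasDerivWithinAt_nonneg (convex_Ici r) (f' := p)
        hqc.continuousOn (fun s _ => (hq s).hasDerivWithinAt) ?_
      intro s hs
      rw [interior_Ici] at hs
      have hs : r < s := hs
      have h1 : r * p r ≤ s * p s := rpmono hr (hr.trans hs.le) hs.le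
      have h2 : 0 < r * p r := mul_pos (by linarith) hlt
      by_contra! h3
      nlinarith
    have : q r ≤ 0 := by
      refine ge_of_tendsto tq ?_
      filter_upwards [eventually_ge_atTop r] with s hs
      exact hmon self_mem_Ici hs hs
    linarith [hpos r]
  have ple : ∀ r, R ≤ r → p r ≤ -(q r / 2) := by
    intro r hr
    have h0 := Hnn r (hR1.trans hr)
    have h1 := hqs r hr
    have h2 := hpos r
    have h3 := pneg r hr
    have h4 : q r ^ 4 ≤ q r ^ 2 := by
      have : q r ^ 4 = q r ^ 2 * q r ^ 2 := by ring
      have h3 : q r ^ 2 ≤ 1 := by nlinarith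
      nlinarith [sq_nonneg (q r)]
    have h5 : (q r / 2) ^ 2 ≤ (-p r) ^ 2 := by nlinarith
    have := abs_le_of_sq_le_sq h5 (by linarith)
    linarith [le_abs_self (q r / 2)]
  have eanti : AntitoneOn (fun r => q r * Real.exp (r / 2)) (Ici R) := by
    have d : ∀ r, HasDerivAt (fun r => q r * Real.exp (r / 2))
        ((p r + q r / 2) * Real.exp (r / 2)) r := by
      intro r
      refine ((hq r).mul (((hasDerivAt_id r).div_const 2).exp)).congr_deriv ?_
      simp; ring
    refine antitoneOn_of_hasDerivWithinAt_nonpos (convex_Ici R)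
      (fun r _ => (d r).continuousAt.continuousWithinAt)
      (fun r _ => (d r).hasDerivWithinAt) ?_
    intro r hr
    rw [interior_Ici] at hr
    have := ple r (le_of_lt hr)
    exact mul_nonpos_of_nonpos_of_nonneg (by linarith) (Real.exp_pos _).le
  set C := q R * Real.exp (R / 2) with hC
  have hC0 : 0 < C := mul_pos (hpos R) (Real.exp_pos _)
  have qle : ∀ r, R ≤ r → q r ≤ C * Real.exp (-(r / 2)) := by
    intro r hr
    have : q r * Real.exp (r / 2) ≤ C := eanti self_mem_Ici hr hr
    rw [Real.exp_neg, ← div_eq_mul_inv, le_div_iff₀ (Real.exp_pos _)]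
    exact this
  refine ⟨C * Real.exp (1 / 2), R + 1, by positivity, by linarith, fun r hr => ⟨?_, ?_⟩⟩
  · refine (qle r (by linarith)).trans ?_
    gcongr
    exact le_mul_of_one_le_right hC0.le (Real.one_le_exp (by norm_num))
  · obtain ⟨s, hs, hs'⟩ := exists_hasDerivAt_eq_slope q p (show r - 1 < r by linarith)
      hqc.continuousOn (fun s _ => hq s)
    have h1 : s * p s ≤ r * p r :=
      rpmono (show R ≤ s by linarith [hs.1]) (show R ≤ r by linarith) hs.2.le
    have h2 := qle (r - 1) (by linarith)
    have h3 : -p s ≤ q (r - 1) := by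
      rw [hs']; simp; linarith [hpos r]
    have h4 := pneg s (by linarith [hs.1])
    have h5 : r * (-p r) ≤ r * (-p s) := by nlinarith [hs.2]
    have h6 : -p r ≤ -p s := le_of_mul_le_mul_left h5 (by linarith)
    rw [abs_of_nonpos (pneg r (by linarith))]
    refine (h6.trans (h3.trans h2)).trans_eq ?_
    rw [mul_assoc C, ← Real.exp_add]
    congr 2; ring

theorem integral_virial_of_radial_ode {q p : ℝ → ℝ} (hq : ∀ r, HasDerivAt q (p r) r)
    (hpc : Continuous p)
    (hp : ∀ r, 0 < r → HasDerivAt p (q r - q r ^ 3 - p r / r) r) {R : ℝ} (hR : 0 ≤ R) :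
    ∫ r in (0 : ℝ)..R, r * (p r ^ 2 - q r ^ 4 / 2) =
      R * q R * p R + R ^ 2 * (p R ^ 2 + q R ^ 4 / 2 - q R ^ 2) / 2 := by
  have hqc : Continuous q := continuous_iff_continuousAt.2 fun r => (hq r).continuousAt
  have := intervalIntegral.integral_eq_sub_of_hasDerivAt_of_le hR
    (f := fun r => r * q r * p r + r ^ 2 * (p r ^ 2 + q r ^ 4 / 2 - q r ^ 2) / 2)
    (f' := fun r => r * (p r ^ 2 - q r ^ 4 / 2)) (by fun_prop) ?_
    (Continuous.intervalIntegrable (by fun_prop) _ _)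
  · simpa using this
  · intro r hr
    have hr0 : 0 < r := hr.1
    have d1 := ((hasDerivAt_id r).mul (hq r)).mul (hp r hr0)
    have d2 := (((hp r hr0).pow 2).add (((hq r).pow 4).div_const 2)).sub ((hq r).pow 2)
    have d3 := d1.add ((((hasDerivAt_id r).pow 2).mul d2).div_const 2)
    refine d3.congr_deriv ?_
    simp; field_simp; ring

theorem norm_e0 : ‖e0‖ = 1 := by simp [e0]

theorem norm_e1 : ‖e1‖ = 1 := by simp [e1]

theorem inner_e0_e1 : inner ℝ e0 e1 = 0 := by simp [e0, e1, PiLp.inner_apply]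

theorem hasFDerivAt_norm_plane {x : Plane} (hx : x ≠ 0) :
    HasFDerivAt (fun y : Plane => ‖y‖) (‖x‖⁻¹ • innerSL ℝ x) x := by
  have h := (hasStrictFDerivAt_norm_sq x).hasFDerivAt.sqrt (by positivity)
  have e : (fun y : Plane => √(‖y‖ ^ 2)) = fun y => ‖y‖ :=
    funext fun y => Real.sqrt_sq (norm_nonneg y)
  rw [e] at h
  refine h.congr_fderiv ?_
  rw [Real.sqrt_sq (norm_nonneg x)]
  ext v
  simp
  field_simp

theorem contDiff_directional {Q : Plane → ℝ} (hQ : ContDiff ℝ 2 Q) (v : Plane) :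
    ContDiff ℝ 1 (fun x => fderiv ℝ Q x v) :=
  (hQ.fderiv_right (m := 1) (by norm_num)).clm_apply contDiff_const

theorem IsGroundState.exists_radial_profile {Q : Plane → ℝ} (hQ : IsGroundState Q) :
    ∃ q p : ℝ → ℝ, (∀ x, Q x = q ‖x‖) ∧ (∀ r, HasDerivAt q (p r) r) ∧ Continuous p ∧
      (∀ r, 0 < r → HasDerivAt p (q r - q r ^ 3 - p r / r) r) ∧ (∀ r, 0 < q r) ∧
      (∀ x, x ≠ 0 → HasFDerivAt Q (p ‖x‖ • (‖x‖⁻¹ • innerSL ℝ x)) x) := by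
  obtain ⟨hC, hpos, hrad, -, -, heq⟩ := hQ
  have hdiff : Differentiable ℝ Q := hC.differentiable (by norm_num)
  set q : ℝ → ℝ := fun r => Q (r • e0) with hq_def
  set p : ℝ → ℝ := fun r => d0R Q (r • e0) with hp_def
  have hline : ∀ r : ℝ, HasDerivAt (fun r : ℝ => r • e0) e0 r := fun r => by
    simpa using (hasDerivAt_id r).smul_const e0
  have hQq : ∀ x, Q x = q ‖x‖ := fun x => hrad _ _ (by simp [norm_smul, norm_e0])
  have hq : ∀ r, HasDerivAt q (p r) r := fun r =>
    (hdiff (r • e0)).hasFDerivAt.comp_hasDerivAt r (hline r)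
  have h0 : ContDiff ℝ 1 (d0R Q) := contDiff_directional hC e0
  have h1 : ContDiff ℝ 1 (d1R Q) := contDiff_directional hC e1
  have hpc : Continuous p := h0.continuous.comp (by fun_prop)
  have hfd : ∀ x, x ≠ 0 → HasFDerivAt Q (p ‖x‖ • (‖x‖⁻¹ • innerSL ℝ x)) x := by
    intro x hx
    have := (hq ‖x‖).comp_hasFDerivAt x (hasFDerivAt_norm_plane hx)
    exact this.congr_of_eventuallyEq (Eventually.of_forall hQq)
  refine ⟨q, p, hQq, hq, hpc, ?_, fun r => hpos _, hfd⟩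
  intro r hr
  set x : Plane := r • e0 with hx_def
  have hx : x ≠ 0 := by
    rw [← norm_pos_iff, hx_def, norm_smul, norm_e0]; simpa using hr.ne'
  have hp0 : HasDerivAt p (fderiv ℝ (d0R Q) x e0) r := by
    have h : HasFDerivAt (d0R Q) (fderiv ℝ (d0R Q) x) (r • e0) :=
      ((h0.differentiable one_ne_zero) _).hasFDerivAt
    exact h.comp_hasDerivAt r (hline r)
  have hd1 : fderiv ℝ (d1R Q) x e1 = p r / r := by
    have hl1 : HasDerivAt (fun t : ℝ => x + t • e1) e1 0 := by
      simpa using ((hasDerivAt_id (0 : ℝ)).smul_const e1).const_add x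
    have hD : HasDerivAt (fun t : ℝ => d1R Q (x + t • e1)) (fderiv ℝ (d1R Q) x e1) 0 := by
      have h : HasFDerivAt (d1R Q) (fderiv ℝ (d1R Q) x) (x + (0 : ℝ) • e1) := by
        simpa using ((h1.differentiable one_ne_zero) x).hasFDerivAt
      exact h.comp_hasDerivAt (0 : ℝ) hl1
    have hcont : Continuous fun t : ℝ => x + t • e1 := by fun_prop
    have hne : ∀ᶠ t : ℝ in 𝓝 0, x + t • e1 ≠ 0 :=
      hcont.continuousAt.eventually_ne (by simpa using hx)
    have hform : ∀ᶠ t : ℝ in 𝓝 0,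
        d1R Q (x + t • e1) = t * (p ‖x + t • e1‖ * ‖x + t • e1‖⁻¹) := by
      filter_upwards [hne] with t ht
      rw [d1R, (hfd _ ht).fderiv]
      simp [hx_def, inner_e0_e1, norm_e1]
      ring
    have hg : Tendsto (fun t : ℝ => p ‖x + t • e1‖ * ‖x + t • e1‖⁻¹) (𝓝 0) (𝓝 (p r / r)) := by
      have hc : ContinuousAt (fun t : ℝ => p ‖x + t • e1‖ * ‖x + t • e1‖⁻¹) 0 :=
        (hpc.comp hcont.norm).continuousAt.mul (hcont.norm.continuousAt.inv₀ (by simpa using hx))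
      have := hc.tendsto
      simpa [hx_def, norm_smul, norm_e0, abs_of_pos hr, div_eq_mul_inv] using this
    refine hD.unique ?_
    rw [hasDerivAt_iff_tendsto_slope]
    refine (hg.mono_left nhdsWithin_le_nhds).congr' ?_
    filter_upwards [nhdsWithin_le_nhds hform, self_mem_nhdsWithin] with t ht ht0
    have ht0 : t ≠ 0 := ht0
    rw [slope_def_field, ht, hform.self_of_nhds]
    field_simp
    simp
  have := heq x
  rw [lapR, hd1] at this
  refine hp0.congr_deriv ?_
  change _ = Q x - Q x ^ 3 - _
  linarith

theorem exists_cutoff : ∃ C : ℝ, 0 < C ∧ ∀ R : ℝ, 1 ≤ R → ∃ χ : Plane → ℝ, ContDiff ℝ 1 χ ∧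
    (∀ x, 0 ≤ χ x) ∧ (∀ x, χ x ≤ 1) ∧ (∀ x, ‖x‖ < R → χ x = 1) ∧
    (∀ x, 2 * R ≤ ‖x‖ → χ x = 0) ∧ ∀ x, ‖fderiv ℝ χ x‖ ≤ C := by
  let φ : ContDiffBump (0 : Plane) := ⟨1, 2, one_pos, one_lt_two⟩
  have hφ : ContDiff ℝ 1 φ := φ.contDiff
  obtain ⟨C, hC⟩ := (φ.hasCompactSupport.fderiv ℝ).exists_bound_of_continuous
    (hφ.continuous_fderiv one_ne_zero)
  refine ⟨max C 1, by positivity, fun R hR => ⟨fun x => φ (R⁻¹ • x),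
    hφ.comp (contDiff_const_smul _), fun x => φ.nonneg, fun x => φ.le_one, ?_, ?_, ?_⟩⟩
  · intro x hx
    refine φ.one_of_mem_closedBall ?_
    rw [mem_closedBall_zero_iff, norm_smul, norm_inv, Real.norm_of_nonneg (by linarith),
      inv_mul_le_iff₀ (by linarith)]
    change ‖x‖ ≤ R * 1
    linarith
  · intro x hx
    refine φ.zero_of_le_dist ?_
    rw [dist_zero_right, norm_smul, norm_inv, Real.norm_of_nonneg (by linarith),
      le_inv_mul_iff₀ (by linarith)]
    change R * 2 ≤ ‖x‖
    linarith
  · intro x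
    have hd : HasFDerivAt φ (fderiv ℝ φ (R⁻¹ • x)) (R⁻¹ • x) :=
      (hφ.differentiable one_ne_zero _).hasFDerivAt
    have h := hd.comp x ((hasFDerivAt_id x).const_smul R⁻¹)
    have e : fderiv ℝ (fun x => φ (R⁻¹ • x)) x = R⁻¹ • fderiv ℝ φ (R⁻¹ • x) := by
      refine HasFDerivAt.fderiv (h.congr_fderiv ?_)
      ext v; simp
    rw [e, norm_smul, norm_inv, Real.norm_of_nonneg (by linarith)]
    calc R⁻¹ * ‖fderiv ℝ φ (R⁻¹ • x)‖ ≤ 1 * ‖fderiv ℝ φ (R⁻¹ • x)‖ := by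
          gcongr; exact inv_le_one_of_one_le₀ hR
      _ ≤ max C 1 := by rw [one_mul]; exact (hC _).trans (le_max_left _ _)

theorem continuous_gradSqR {v : Plane → ℝ} (hv : ContDiff ℝ 1 v) : Continuous (gradSqR v) := by
  have := hv.continuous_fderiv one_ne_zero
  unfold gradSqR d0R d1R
  fun_prop

theorem hasCompactSupport_gradSqR {v : Plane → ℝ} (hc : HasCompactSupport v) :
    HasCompactSupport (gradSqR v) := by
  refine (hc.fderiv ℝ).mono fun x hx => ?_
  contrapose! hx
  simp only [Function.mem_support, not_not] at hx ⊢
  simp [gradSqR, d0R, d1R, hx]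

theorem integrable_gradSqR {v : Plane → ℝ} (hv : ContDiff ℝ 1 v) (hc : HasCompactSupport v) :
    Integrable (gradSqR v) :=
  (continuous_gradSqR hv).integrable_of_hasCompactSupport (hasCompactSupport_gradSqR hc)

theorem HasCompactSupport.fun_pow {v : Plane → ℝ} (hc : HasCompactSupport v) {n : ℕ}
    (hn : n ≠ 0) : HasCompactSupport fun x => v x ^ n :=
  hc.comp_left (g := fun t : ℝ => t ^ n) (zero_pow hn)

theorem integrable_fun_pow {v : Plane → ℝ} (hv : Continuous v) (hc : HasCompactSupport v)
    {n : ℕ} (hn : n ≠ 0) : Integrable fun x => v x ^ n :=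
  (hv.pow n).integrable_of_hasCompactSupport (hc.fun_pow hn)

theorem gradSqR_le (v : Plane → ℝ) (x : Plane) : gradSqR v x ≤ 2 * ‖fderiv ℝ v x‖ ^ 2 := by
  have h (e : Plane) (he : ‖e‖ = 1) : (fderiv ℝ v x e) ^ 2 ≤ ‖fderiv ℝ v x‖ ^ 2 := by
    have := (fderiv ℝ v x).le_opNorm e
    rw [he, mul_one] at this
    rw [← sq_abs, ← Real.norm_eq_abs]
    exact pow_le_pow_left₀ (norm_nonneg _) this 2
  have h0 := h e0 norm_e0
  have h1 := h e1 norm_e1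
  unfold gradSqR d0R d1R
  linarith

theorem hasCompactSupport_of_norm {v : Plane → ℝ} {ρ : ℝ} (h : ∀ x, ρ ≤ ‖x‖ → v x = 0) :
    HasCompactSupport v := by
  refine HasCompactSupport.intro (isCompact_closedBall (0 : Plane) ρ) fun x hx => h x ?_
  rw [mem_closedBall_zero_iff, not_le] at hx
  exact hx.le

/-- Integral of the radial extension of `h` on `(0, R)` plus a constant on `[R, 2 * R]`. -/
theorem integral_radial_step {h : ℝ → ℝ} (hh : Continuous h) {R b : ℝ} (hR : 0 ≤ R) :
    Integrable (fun x : Plane =>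
      (Ioo 0 R).indicator h ‖x‖ + (Icc R (2 * R)).indicator (fun _ => b) ‖x‖) ∧
    ∫ x : Plane, ((Ioo 0 R).indicator h ‖x‖ + (Icc R (2 * R)).indicator (fun _ => b) ‖x‖) =
      2 * ((volume : Measure Plane).real (ball 0 1) *
        ((∫ r in (0 : ℝ)..R, r * h r) + 3 / 2 * R ^ 2 * b)) := by
  have e : (fun r : ℝ => r ^ (Module.finrank ℝ Plane - 1) •
      ((Ioo 0 R).indicator h r + (Icc R (2 * R)).indicator (fun _ => b) r)) =
      fun r => (Ioo 0 R).indicator (fun r => r * h r) r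
        + (Icc R (2 * R)).indicator (fun r => r * b) r := by
    funext r
    simp [indicator, mul_add]
  have i1 : IntegrableOn ((Ioo 0 R).indicator (fun r => r * h r)) (Ioi 0) := by
    refine (IntegrableOn.integrable_indicator ?_ measurableSet_Ioo).integrableOn
    exact ((continuous_id.mul hh).integrableOn_Icc (a := 0) (b := R)).mono_set Ioo_subset_Icc_self
  have i2 : IntegrableOn ((Icc R (2 * R)).indicator (fun r => r * b)) (Ioi 0) := by
    refine (IntegrableOn.integrable_indicator ?_ measurableSet_Icc).integrableOn
    exact (continuous_id.mul continuous_const).integrableOn_Icc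
  constructor
  · rw [integrable_fun_norm_addHaar (μ := (volume : Measure Plane))
      (f := fun r => (Ioo 0 R).indicator h r + (Icc R (2 * R)).indicator (fun _ => b) r), e]
    exact i1.add i2
  · rw [integral_fun_norm_addHaar (volume : Measure Plane)
      (fun r => (Ioo 0 R).indicator h r + (Icc R (2 * R)).indicator (fun _ => b) r), e,
      integral_add i1 i2, setIntegral_indicator measurableSet_Ioo,
      setIntegral_indicator measurableSet_Icc]
    have s1 : Ioi (0 : ℝ) ∩ Ioo 0 R = Ioo 0 R := inter_eq_right.2 fun r hr => hr.1
    have s2 : (Ioi (0 : ℝ) ∩ Icc R (2 * R) : Set ℝ) =ᵐ[volume] Ioc R (2 * R) := by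
      have h1 : (Ioc R (2 * R) : Set ℝ) ⊆ Ioi (0 : ℝ) ∩ Icc R (2 * R) :=
        fun r hr => ⟨hR.trans_lt hr.1, Ioc_subset_Icc_self hr⟩
      refine EventuallyLE.antisymm ?_ h1.eventuallyLE
      exact (inter_subset_right.eventuallyLE).trans Ioc_ae_eq_Icc.symm.le
    rw [s1, setIntegral_congr_set s2, ← integral_Ioc_eq_integral_Ioo,
      ← intervalIntegral.integral_of_le hR, ← intervalIntegral.integral_of_le (by linarith)]
    simp only [finrank_euclideanSpace, Fintype.card_fin, smul_eq_mul, nsmul_eq_mul,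
      intervalIntegral.integral_mul_const, integral_id]
    push_cast
    ring

theorem IsGroundState.mass_pos {Q : Plane → ℝ} (hQ : IsGroundState Q) :
    0 < ∫ x, Q x ^ 2 := by
  obtain ⟨-, hpos, -, hint, -⟩ := hQ
  rw [integral_pos_iff_support_of_nonneg (fun x => sq_nonneg _) hint]
  have : Function.support (fun x => Q x ^ 2) = univ := by
    ext x; simpa using (hpos x).ne'
  rw [this]
  exact Measure.measure_univ_pos.2 (NeZero.ne _)

theorem IsGroundState.exists_truncation {Q : Plane → ℝ} (hQ : IsGroundState Q) :
    ∃ K R₀ : ℝ, ∀ R, R₀ ≤ R → ∃ v : Plane → ℝ, ContDiff ℝ 1 v ∧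
      (∀ x, 2 * R ≤ ‖x‖ → v x = 0) ∧ ∫ x, v x ^ 2 ≤ ∫ x, Q x ^ 2 ∧
      (∫ x, Q x ^ 2) / 2 ≤ ∫ x, v x ^ 2 ∧
      (∫ x, gradSqR v x) - 1 / 2 * ∫ x, v x ^ 4 ≤ K * (R ^ 2 * Real.exp (-R)) := by
  have hmass := hQ.mass_pos
  obtain ⟨q, p, hQq, hq, hpc, hp, hqpos, hfd⟩ := hQ.exists_radial_profile
  obtain ⟨hC, hpos, -, hint, hgint, -⟩ := hQ
  have hqc : Continuous q := continuous_iff_continuousAt.2 fun r => (hq r).continuousAt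
  have hne : ∀ᵐ x : Plane, x ≠ 0 := by simp [ae_iff]
  have hnorm : ∀ x, x ≠ 0 → ‖fderiv ℝ Q x‖ = |p ‖x‖| := by
    intro x hx
    have : ‖x‖ ≠ 0 := norm_ne_zero_iff.2 hx
    rw [(hfd x hx).fderiv, norm_smul, norm_smul, innerSL_apply_norm, norm_inv, norm_norm,
      inv_mul_cancel₀ this, mul_one, Real.norm_eq_abs]
  have hgrad : ∀ x, x ≠ 0 → gradSqR Q x = p ‖x‖ ^ 2 := by
    intro x hx
    have h0 : ‖x‖ ≠ 0 := norm_ne_zero_iff.2 hx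
    have h1 : ‖x‖ ^ 2 = x 0 ^ 2 + x 1 ^ 2 := by
      rw [EuclideanSpace.norm_sq_eq]; simp
    rw [gradSqR, d0R, d1R, (hfd x hx).fderiv]
    have i0 : inner ℝ x e0 = x 0 := by simp [e0, EuclideanSpace.inner_single_right]
    have i1 : inner ℝ x e1 = x 1 := by simp [e1, EuclideanSpace.inner_single_right]
    simp [i0, i1]
    field_simp
    rw [h1]
  have hq2 : IntegrableOn (fun r => r * q r ^ 2) (Ioi 0) := by
    have : Integrable (fun x : Plane => q ‖x‖ ^ 2) := hint.congr
      (Eventually.of_forall fun x => by simp only [hQq x])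
    rw [integrable_fun_norm_addHaar (μ := (volume : Measure Plane)) (f := fun r => q r ^ 2)] at this
    simpa using this
  have hp2 : IntegrableOn (fun r => r * p r ^ 2) (Ioi 0) := by
    have : Integrable (fun x : Plane => p ‖x‖ ^ 2) := hgint.congr
      (hne.mono fun x hx => by simp only [hnorm x hx, sq_abs])
    rw [integrable_fun_norm_addHaar (μ := (volume : Measure Plane)) (f := fun r => p r ^ 2)] at this
    simpa using this
  obtain ⟨A, R₁, hA, hR₁, hdec⟩ := decay_of_radial_ode hq hp hqpos hq2 hp2
  obtain ⟨c, hc, hcut⟩ := exists_cutoff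
  have hball : Tendsto (fun R : ℝ => ∫ x in ball (0 : Plane) R, Q x ^ 2) atTop
      (𝓝 (∫ x, Q x ^ 2)) :=
    (aecover_ball tendsto_id).integral_tendsto_of_countably_generated hint
  obtain ⟨R₂, hR₂⟩ := eventually_atTop.1
    (hball.eventually_const_le (show (∫ x, Q x ^ 2) / 2 < ∫ x, Q x ^ 2 by linarith))
  set B := 2 * ((1 + c) * A) ^ 2 with hB
  set ω := (volume : Measure Plane).real (ball 0 1) with hω
  refine ⟨2 * (ω * (2 * A ^ 2 + A ^ 4 + 3 / 2 * B)), max R₁ R₂, fun R hR => ?_⟩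
  have hRR₁ : R₁ ≤ R := (le_max_left _ _).trans hR
  have hRR₂ : R₂ ≤ R := (le_max_right _ _).trans hR
  have hR1 : 1 ≤ R := hR₁.trans hRR₁
  obtain ⟨χ, hχ, hχ0, hχ1, hχR, hχ2R, hχd⟩ := hcut R hR1
  set v : Plane → ℝ := fun x => χ x * Q x with hv
  have hvC : ContDiff ℝ 1 v := hχ.mul (hC.of_le (by norm_num))
  have hv0 : ∀ x, 2 * R ≤ ‖x‖ → v x = 0 := fun x hx => by simp [hv, hχ2R x hx]
  have hvc : HasCompactSupport v := hasCompactSupport_of_norm hv0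
  have hv2 := integrable_fun_pow hvC.continuous hvc two_ne_zero
  have hv4 := integrable_fun_pow hvC.continuous hvc four_ne_zero
  have hvg := integrable_gradSqR hvC hvc
  refine ⟨v, hvC, hv0, ?_, ?_, ?_⟩
  · refine integral_mono hv2 hint fun x => ?_
    simp only [hv, mul_pow]
    exact mul_le_of_le_one_left (sq_nonneg _) (pow_le_one₀ (hχ0 x) (hχ1 x))
  · refine (hR₂ R hRR₂).trans ?_
    refine le_trans (le_of_eq ?_) (setIntegral_le_integral (s := ball (0 : Plane) R) hv2
      (Eventually.of_forall fun x => sq_nonneg _))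
    refine setIntegral_congr_fun measurableSet_ball fun x hx => ?_
    rw [mem_ball_zero_iff] at hx
    simp [hv, hχR x hx]
  · have hpt : ∀ᵐ x : Plane, gradSqR v x - 1 / 2 * v x ^ 4 ≤
        (Ioo 0 R).indicator (fun r => p r ^ 2 - q r ^ 4 / 2) ‖x‖ +
          (Icc R (2 * R)).indicator (fun _ => B * Real.exp (-R)) ‖x‖ := by
      filter_upwards [hne] with x hx
      have hx0 : 0 < ‖x‖ := norm_pos_iff.2 hx
      have hv4 : 0 ≤ v x ^ 4 := by positivity
      rcases lt_or_ge ‖x‖ R with hxR | hxR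
      · have hloc : v =ᶠ[𝓝 x] Q := by
          filter_upwards [(isOpen_ball (x := (0 : Plane)) (ε := R)).mem_nhds
            (by simpa using hxR)] with y hy
          rw [mem_ball_zero_iff] at hy
          simp [hv, hχR y hy]
        have e1 : gradSqR v x = p ‖x‖ ^ 2 := by
          rw [← hgrad x hx]
          simp only [gradSqR, d0R, d1R, hloc.fderiv_eq]
        rw [e1, hloc.self_of_nhds, hQq x, indicator_of_mem (show ‖x‖ ∈ Ioo 0 R from ⟨hx0, hxR⟩),
          indicator_of_notMem (fun h => absurd h.1 (not_le.2 hxR))]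
        apply le_of_eq; ring
      · rw [indicator_of_notMem (fun h => absurd h.2 (not_lt.2 hxR)), zero_add]
        rcases le_or_gt ‖x‖ (2 * R) with hx2 | hx2
        · rw [indicator_of_mem (show ‖x‖ ∈ Icc R (2 * R) from ⟨hxR, hx2⟩)]
          have hd : HasFDerivAt v (χ x • fderiv ℝ Q x + Q x • fderiv ℝ χ x) x :=
            (hχ.differentiable one_ne_zero x).hasFDerivAt.mul
              (hC.differentiable two_ne_zero x).hasFDerivAt
          obtain ⟨hd1, hd2⟩ := hdec ‖x‖ (hRR₁.trans hxR)
          have hexp : Real.exp (-(‖x‖ / 2)) ≤ Real.exp (-(R / 2)) := by gcongr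
          have hb : ‖fderiv ℝ v x‖ ≤ (1 + c) * A * Real.exp (-(R / 2)) := by
            rw [hd.fderiv]
            calc ‖χ x • fderiv ℝ Q x + Q x • fderiv ℝ χ x‖
                ≤ χ x * |p ‖x‖| + q ‖x‖ * ‖fderiv ℝ χ x‖ := by
                  refine (norm_add_le _ _).trans_eq ?_
                  rw [norm_smul, norm_smul, hnorm x hx, Real.norm_of_nonneg (hχ0 x),
                    Real.norm_of_nonneg (hpos x).le, ← hQq x]
              _ ≤ 1 * (A * Real.exp (-(R / 2))) + (A * Real.exp (-(R / 2))) * c := by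
                  have t1 : |p ‖x‖| ≤ A * Real.exp (-(R / 2)) := hd2.trans (by gcongr)
                  have t2 : q ‖x‖ ≤ A * Real.exp (-(R / 2)) := hd1.trans (by gcongr)
                  have := hχ1 x
                  have := hχd x
                  gcongr
              _ = (1 + c) * A * Real.exp (-(R / 2)) := by ring
          have hg := gradSqR_le v x
          have : ‖fderiv ℝ v x‖ ^ 2 ≤ ((1 + c) * A * Real.exp (-(R / 2))) ^ 2 := by gcongr
          have e : Real.exp (-(R / 2)) ^ 2 = Real.exp (-R) := by
            rw [← Real.exp_nat_mul]; congr 1; push_cast; ring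
          rw [mul_pow, e] at this
          rw [hB]
          linarith
        · rw [indicator_of_notMem (fun h => absurd h.2 (not_le.2 hx2))]
          have hloc : v =ᶠ[𝓝 x] fun _ => 0 := by
            filter_upwards [continuous_norm.continuousAt.eventually_const_lt hx2] with y hy
            exact hv0 y hy.le
          have : gradSqR v x = 0 := by
            simp [gradSqR, d0R, d1R, hloc.fderiv_eq]
          linarith
    obtain ⟨si, se⟩ := integral_radial_step (h := fun r => p r ^ 2 - q r ^ 4 / 2)
      (by fun_prop) (b := B * Real.exp (-R)) (show 0 ≤ R by linarith)
    have hle := integral_mono_ae (hvg.sub (hv4.const_mul (1 / 2))) si hpt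
    rw [se, integral_virial_of_radial_ode hq hpc hp (by linarith)] at hle
    have e : (∫ x, gradSqR v x) - 1 / 2 * ∫ x, v x ^ 4 =
        ∫ x, (gradSqR v - (fun x => 1 / 2 * v x ^ 4 : Plane → ℝ)) x := by
      rw [← integral_const_mul, ← integral_sub hvg (hv4.const_mul _)]
      rfl
    rw [e]
    refine hle.trans ?_
    rw [show 2 * (ω * (2 * A ^ 2 + A ^ 4 + 3 / 2 * B)) * (R ^ 2 * Real.exp (-R)) =
      2 * (ω * ((2 * A ^ 2 + A ^ 4 + 3 / 2 * B) * (R ^ 2 * Real.exp (-R)))) by ring]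
    have hω0 : 0 ≤ ω := measureReal_nonneg
    gcongr
    obtain ⟨d1, d2⟩ := hdec R hRR₁
    set b := Real.exp (-(R / 2)) with hb
    have hb0 : 0 < b := Real.exp_pos _
    have hb1 : b ≤ 1 := Real.exp_le_one_iff.2 (by linarith)
    have eb : Real.exp (-R) = b ^ 2 := by
      rw [hb, ← Real.exp_nat_mul]; congr 1; push_cast; ring
    rw [eb]
    have hq0 := hqpos R
    have t1 : R * q R * p R ≤ R ^ 2 * (A ^ 2 * b ^ 2) := by
      have : q R * p R ≤ (A * b) * (A * b) := by
        calc q R * p R ≤ q R * |p R| := by gcongr; exact le_abs_self _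
          _ ≤ _ := by gcongr
      calc R * q R * p R = R * (q R * p R) := by ring
        _ ≤ R * ((A * b) * (A * b)) := by gcongr
        _ ≤ R ^ 2 * ((A * b) * (A * b)) := by gcongr; nlinarith
        _ = _ := by ring
    have t2 : p R ^ 2 ≤ A ^ 2 * b ^ 2 := by
      rw [← sq_abs, ← mul_pow]; gcongr
    have t3 : q R ^ 4 ≤ A ^ 4 * b ^ 2 := by
      calc q R ^ 4 ≤ (A * b) ^ 4 := by gcongr
        _ = A ^ 4 * b ^ 2 * b ^ 2 := by ring
        _ ≤ A ^ 4 * b ^ 2 * 1 := by gcongr; exact pow_le_one₀ hb0.le hb1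
        _ = _ := by ring
    have t4 : R ^ 2 * (p R ^ 2 + q R ^ 4 / 2 - q R ^ 2) / 2 ≤
        R ^ 2 * (A ^ 2 * b ^ 2 + A ^ 4 * b ^ 2) := by
      have : 0 ≤ A ^ 2 * b ^ 2 := by positivity
      have : 0 ≤ A ^ 4 * b ^ 2 := by positivity
      have : p R ^ 2 + q R ^ 4 / 2 - q R ^ 2 ≤ 2 * (A ^ 2 * b ^ 2 + A ^ 4 * b ^ 2) := by
        nlinarith [sq_nonneg (q R)]
      have := mul_le_mul_of_nonneg_left this (sq_nonneg R)
      linarith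
    calc R * q R * p R + R ^ 2 * (p R ^ 2 + q R ^ 4 / 2 - q R ^ 2) / 2 + 3 / 2 * R ^ 2 * (B * b ^ 2)
        ≤ R ^ 2 * (A ^ 2 * b ^ 2) + R ^ 2 * (A ^ 2 * b ^ 2 + A ^ 4 * b ^ 2)
          + 3 / 2 * R ^ 2 * (B * b ^ 2) := by gcongr
      _ = _ := by ring

theorem locallyIntegrable_log_norm : LocallyIntegrable (fun x : Plane => Real.log ‖x‖) := by
  rw [locallyIntegrable_iff]
  intro K hK
  obtain ⟨r, hr⟩ := hK.isBounded.subset_closedBall (0 : Plane)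
  refine IntegrableOn.mono_set ?_ hr
  rw [← integrable_indicator_iff measurableSet_closedBall]
  have e : (closedBall (0 : Plane) r).indicator (fun x => Real.log ‖x‖) =
      fun x => (Iic r).indicator Real.log ‖x‖ := by
    funext x
    simp [indicator]
  rw [e, integrable_fun_norm_addHaar]
  have e2 : (fun y : ℝ => y ^ (Module.finrank ℝ Plane - 1) • (Iic r).indicator Real.log y) =
      (Iic r).indicator fun y => y * Real.log y := by
    funext y
    simp [indicator]
  rw [e2, integrableOn_indicator_iff measurableSet_Iic]
  refine (Real.continuous_mul_log.integrableOn_Icc (a := 0) (b := r)).mono_set ?_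
  rintro y ⟨hy, hy'⟩
  exact ⟨le_of_lt hy', hy⟩

theorem logConv_ofReal_le {w : Plane → ℝ} (hw : Continuous w) {ρ : ℝ}
    (hρ : ∀ x, ρ ≤ ‖x‖ → w x = 0) :
    logConv (fun x => (w x : ℂ)) ≤ Real.log (2 * ρ) * (∫ x, w x ^ 2) ^ 2 := by
  have hc := hasCompactSupport_of_norm hρ
  have hc2 : HasCompactSupport fun x => w x ^ 2 := hc.fun_pow two_ne_zero
  have hw2 : Continuous fun x => w x ^ 2 := hw.pow 2
  have hi2 : Integrable fun x => w x ^ 2 := hw2.integrable_of_hasCompactSupport hc2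
  set G : Plane → ℝ := fun x => ∫ y, Real.log ‖x - y‖ * w y ^ 2 with hG
  have hGc : Continuous G := by
    have h := hc2.continuous_convolution_right (ContinuousLinearMap.lsmul ℝ ℝ)
      locallyIntegrable_log_norm hw2
    refine h.congr fun x => ?_
    rw [convolution_eq_swap]
    simp [hG]
  have hGi : ∀ x, Integrable fun y => Real.log ‖x - y‖ * w y ^ 2 := by
    intro x
    have h := (hc2.convolutionExists_right (ContinuousLinearMap.lsmul ℝ ℝ)
      locallyIntegrable_log_norm hw2 x).integrable_swap
    simpa using h
  have hle : ∀ x, ‖x‖ < ρ → G x ≤ Real.log (2 * ρ) * ∫ y, w y ^ 2 := by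
    intro x hx
    rw [← integral_const_mul]
    refine integral_mono_ae (hGi x) (hi2.const_mul _) ?_
    have hne : ∀ᵐ y : Plane, y ≠ x := by simp [ae_iff]
    filter_upwards [hne] with y hy
    rcases le_or_gt ρ ‖y‖ with h | h
    · simp [hρ y h]
    · have h0 : 0 < ‖x - y‖ := norm_pos_iff.2 (sub_ne_zero.2 hy.symm)
      have h1 : ‖x - y‖ ≤ 2 * ρ := (norm_sub_le _ _).trans (by linarith)
      exact mul_le_mul_of_nonneg_right (Real.log_le_log h0 h1) (sq_nonneg _)
  have e : logConv (fun x => (w x : ℂ)) = ∫ x, w x ^ 2 * G x := by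
    unfold logConv
    refine integral_congr_ae (Eventually.of_forall fun x => ?_)
    simp only [Complex.norm_real, Real.norm_eq_abs, sq_abs, hG]
    rw [← integral_const_mul]
    refine integral_congr_ae (Eventually.of_forall fun y => ?_)
    simp only
    ring
  rw [e]
  calc ∫ x, w x ^ 2 * G x ≤ ∫ x, w x ^ 2 * (Real.log (2 * ρ) * ∫ y, w y ^ 2) := by
        refine integral_mono ((hw2.mul hGc).integrable_of_hasCompactSupport hc2.mul_right)
          (hi2.mul_const _) fun x => ?_
        rcases le_or_gt ρ ‖x‖ with h | h
        · simp [hρ x h]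
        · exact mul_le_mul_of_nonneg_left (hle x h) (sq_nonneg _)
    _ = _ := by rw [integral_mul_const]; ring

theorem fderiv_ofReal_comp {w : Plane → ℝ} (hw : Differentiable ℝ w) (x e : Plane) :
    fderiv ℝ (fun y => (w y : ℂ)) x e = (fderiv ℝ w x e : ℂ) := by
  have h : HasFDerivAt (fun y => (w y : ℂ)) (Complex.ofRealCLM.comp (fderiv ℝ w x)) x :=
    Complex.ofRealCLM.hasFDerivAt.comp x (hw x).hasFDerivAt
  rw [h.fderiv]
  simp

theorem gradSq_ofReal {w : Plane → ℝ} (hw : Differentiable ℝ w) (x : Plane) :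
    gradSq (fun y => (w y : ℂ)) x = gradSqR w x := by
  simp [gradSq, gradSqR, d0, d1, d0R, d1R, fderiv_ofReal_comp hw]

theorem momentum_ofReal {w : Plane → ℝ} (hw : Differentiable ℝ w) (x : Plane) :
    momentum (fun y => (w y : ℂ)) x = 0 := by
  simp [momentum, d0, d1, fderiv_ofReal_comp hw]

theorem fderiv_mul_comp_smul {v : Plane → ℝ} (hv : Differentiable ℝ v) (c τ : ℝ) (x : Plane) :
    fderiv ℝ (fun y => c * v (τ • y)) x = (c * τ) • fderiv ℝ v (τ • x) := by
  have h := ((hv (τ • x)).hasFDerivAt.comp x ((hasFDerivAt_id x).const_smul τ)).const_mul c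
  refine HasFDerivAt.fderiv (h.congr_fderiv ?_)
  ext e
  simp [mul_assoc]

theorem gradSqR_mul_comp_smul {v : Plane → ℝ} (hv : Differentiable ℝ v) (c τ : ℝ) (x : Plane) :
    gradSqR (fun y => c * v (τ • y)) x = (c * τ) ^ 2 * gradSqR v (τ • x) := by
  simp only [gradSqR, d0R, d1R, fderiv_mul_comp_smul hv]
  simp
  ring

theorem Ea_mul_ofReal (V : Plane → ℝ) (Ω s : ℝ) {w : Plane → ℝ} (hw : Differentiable ℝ w) :
    Ea V Ω (fun x => ((s * w x : ℝ) : ℂ)) =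
      s ^ 2 * (∫ x, (gradSqR w x + V x * w x ^ 2)) +
        (s ^ 2) ^ 2 * (1 / 2 * logConv (fun x => (w x : ℂ)) - 1 / 2 * ∫ x, w x ^ 4) := by
  have hsw : Differentiable ℝ fun x => s * w x := hw.const_mul s
  have e1 : ∫ x, (gradSq (fun x => ((s * w x : ℝ) : ℂ)) x + V x * ‖((s * w x : ℝ) : ℂ)‖ ^ 2) =
      s ^ 2 * ∫ x, (gradSqR w x + V x * w x ^ 2) := by
    rw [← integral_const_mul]
    refine integral_congr_ae (Eventually.of_forall fun x => ?_)
    have := gradSqR_mul_comp_smul hw s 1 x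
    simp only [one_smul, mul_one] at this
    simp only [gradSq_ofReal hsw, this, Complex.norm_real, Real.norm_eq_abs, sq_abs]
    ring
  have e2 : logConv (fun x => ((s * w x : ℝ) : ℂ)) =
      (s ^ 2) ^ 2 * logConv (fun x => (w x : ℂ)) := by
    unfold logConv
    rw [← integral_const_mul]
    refine integral_congr_ae (Eventually.of_forall fun x => ?_)
    simp only
    rw [← integral_const_mul]
    refine integral_congr_ae (Eventually.of_forall fun y => ?_)
    simp only [Complex.norm_real, Real.norm_eq_abs, sq_abs]
    ring
  have e3 : ∫ x, ‖((s * w x : ℝ) : ℂ)‖ ^ 4 = (s ^ 2) ^ 2 * ∫ x, w x ^ 4 := by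
    rw [← integral_const_mul]
    refine integral_congr_ae (Eventually.of_forall fun x => ?_)
    have : |s * w x| ^ 4 = (|s * w x| ^ 2) ^ 2 := by ring
    simp only [Complex.norm_real, Real.norm_eq_abs, this, sq_abs]
    ring
  simp only [Ea, e1, e2, e3, momentum_ofReal hsw, integral_zero]
  ring

theorem integrable_potential {V : Plane → ℝ} (hV : V110 V) {w : Plane → ℝ} (hw : Continuous w)
    (hc : HasCompactSupport w) : Integrable fun x => V x * w x ^ 2 := by
  obtain ⟨hm, h0, hloc, -⟩ := hV
  obtain ⟨R, hR⟩ := hc.isCompact.isBounded.subset_closedBall (0 : Plane)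
  obtain ⟨C, hC⟩ := hloc R
  refine Integrable.mono' ((integrable_fun_pow hw hc two_ne_zero).const_mul C)
    (by fun_prop) (Eventually.of_forall fun x => ?_)
  rw [Real.norm_of_nonneg (mul_nonneg (h0 x) (sq_nonneg _))]
  by_cases hx : w x = 0
  · simp [hx]
  · refine mul_le_mul_of_nonneg_right (hC x ?_) (sq_nonneg _)
    simpa using hR (subset_tsupport w hx)

theorem mul_ofReal_mem_Sset {V : Plane → ℝ} (hV : V110 V) {w : Plane → ℝ}
    (hw : ContDiff ℝ 1 w) (hc : HasCompactSupport w) (s : ℝ) :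
    (fun x => ((s * w x : ℝ) : ℂ)) ∈ Sset V (s ^ 2 * ∫ x, w x ^ 2) := by
  have hsw : ContDiff ℝ 1 fun x => s * w x := contDiff_const.mul hw
  have hsc : HasCompactSupport fun x => s * w x := hc.mul_left
  have hd := hsw.differentiable one_ne_zero
  refine ⟨⟨⟨Complex.ofRealCLM.differentiable.comp hd, ?_, ?_⟩, ?_⟩, ?_⟩
  · simpa only [Complex.norm_real, Real.norm_eq_abs, sq_abs] using
      integrable_fun_pow hsw.continuous hsc two_ne_zero
  · exact (integrable_gradSqR hsw hsc).congr
      (Eventually.of_forall fun x => (gradSq_ofReal hd x).symm)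
  · simpa only [Complex.norm_real, Real.norm_eq_abs, sq_abs] using
      integrable_potential hV hsw.continuous hsc
  · simp only [Complex.norm_real, Real.norm_eq_abs, sq_abs, mul_pow]
    rw [integral_const_mul]

theorem integral_comp_smul_plane (f : Plane → ℝ) {τ : ℝ} :
    ∫ x, f (τ • x) = (τ ^ 2)⁻¹ * ∫ x, f x := by
  rw [Measure.integral_comp_smul]
  simp

theorem exists_energy_lt_at_critical_mass {V : Plane → ℝ} (hV : V110 V) {Q : Plane → ℝ}
    (hQ : IsGroundState Q) (M : ℝ) :
    ∃ w : Plane → ℝ, ContDiff ℝ 1 w ∧ HasCompactSupport w ∧ ∫ x, w x ^ 2 = ∫ x, Q x ^ 2 ∧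
      (∫ x, (gradSqR w x + V x * w x ^ 2)) +
        (1 / 2 * logConv (fun x => (w x : ℂ)) - 1 / 2 * ∫ x, w x ^ 4) < M := by
  have hmass := hQ.mass_pos
  obtain ⟨K, R₀, htr⟩ := hQ.exists_truncation
  set a := ∫ x, Q x ^ 2 with ha
  obtain ⟨C, hC⟩ := hV.2.2.1 1
  have hlim : Tendsto (fun R : ℝ => 2 * |K| * (R ^ 6 * Real.exp (-R)) + C * a +
      a ^ 2 / 2 * (Real.log 4 - Real.log R)) atTop atBot := by
    have h1 : Tendsto (fun R : ℝ => 2 * |K| * (R ^ 6 * Real.exp (-R)) + C * a) atTop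
        (𝓝 (2 * |K| * 0 + C * a)) :=
      ((Real.tendsto_pow_mul_exp_neg_atTop_nhds_zero 6).const_mul _).add_const _
    refine h1.add_atBot (Tendsto.const_mul_atBot (by positivity) ?_)
    exact tendsto_atBot_add_const_left _ _ (tendsto_neg_atTop_atBot.comp Real.tendsto_log_atTop)
  obtain ⟨R, hRM, hRR₀, hR2⟩ := ((hlim.eventually_lt_atBot M).and
    ((eventually_ge_atTop R₀).and (eventually_ge_atTop 2))).exists
  obtain ⟨v, hv, hv0, hva, hva2, hvD⟩ := htr R hRR₀
  set m := ∫ x, v x ^ 2 with hm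
  set D := ∫ x, gradSqR v x with hD
  set P := ∫ x, v x ^ 4 with hP
  have hP0 : 0 ≤ P := integral_nonneg fun x => by positivity
  have hm0 : 0 < m := by linarith
  set l := a / m with hl
  have hl1 : 1 ≤ l := (one_le_div hm0).2 hva
  have hl2 : l ≤ 2 := (div_le_iff₀ hm0).2 (by linarith)
  have hlm : l * m = a := div_mul_cancel₀ _ hm0.ne'
  set c := √l with hcdef
  have hc2 : c ^ 2 = l := Real.sq_sqrt (by linarith)
  set τ := R ^ 2 with hτ
  have hτ0 : 0 < τ := by positivity
  have hvd := hv.differentiable one_ne_zero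
  set w : Plane → ℝ := fun x => (c * τ) * v (τ • x) with hw
  have hwC : ContDiff ℝ 1 w := contDiff_const.mul (hv.comp (contDiff_const_smul _))
  have hw0 : ∀ x, 2 / R ≤ ‖x‖ → w x = 0 := by
    intro x hx
    have : v (τ • x) = 0 := by
      refine hv0 _ ?_
      rw [norm_smul, Real.norm_of_nonneg hτ0.le, hτ]
      rw [div_le_iff₀ (by linarith)] at hx
      nlinarith
    simp [hw, this]
  have hwc := hasCompactSupport_of_norm hw0
  have hmw : ∫ x, w x ^ 2 = a := by
    simp only [hw, mul_pow]
    rw [integral_const_mul, integral_comp_smul_plane fun x => v x ^ 2, hc2, ← hm, ← hlm]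
    field_simp
  have hP4 : ∫ x, w x ^ 4 = l ^ 2 * τ ^ 2 * P := by
    simp only [hw, mul_pow]
    rw [integral_const_mul, integral_comp_smul_plane fun x => v x ^ 4, ← hc2, ← hP]
    field_simp
  have hDw : ∫ x, gradSqR w x = l * τ ^ 2 * D := by
    simp only [hw, gradSqR_mul_comp_smul hvd]
    rw [integral_const_mul, integral_comp_smul_plane (gradSqR v), ← hc2, ← hD]
    field_simp
  have hVw : ∫ x, V x * w x ^ 2 ≤ C * a := by
    rw [← hmw, ← integral_const_mul]
    refine integral_mono (integrable_potential hV hwC.continuous hwc)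
      ((integrable_fun_pow hwC.continuous hwc two_ne_zero).const_mul C) fun x => ?_
    rcases le_or_gt (2 / R) ‖x‖ with h | h
    · simp [hw0 x h]
    · refine mul_le_mul_of_nonneg_right (hC x (h.le.trans ?_)) (sq_nonneg _)
      exact (div_le_one (by linarith)).2 hR2
  have hL := logConv_ofReal_le hwC.continuous hw0
  rw [hmw, show 2 * (2 / R) = 4 / R by ring,
    Real.log_div (by norm_num) (by linarith)] at hL
  refine ⟨w, hwC, hwc, hmw, lt_of_le_of_lt ?_ hRM⟩
  rw [integral_add (integrable_gradSqR hwC hwc) (integrable_potential hV hwC.continuous hwc),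
    hDw, hP4]
  have hX : 0 ≤ R ^ 2 * Real.exp (-R) := by positivity
  have h1 : l * τ ^ 2 * D - 1 / 2 * (l ^ 2 * τ ^ 2 * P) ≤
      2 * |K| * (R ^ 6 * Real.exp (-R)) := by
    calc l * τ ^ 2 * D - 1 / 2 * (l ^ 2 * τ ^ 2 * P)
        ≤ l * τ ^ 2 * (D - 1 / 2 * P) := by
          have : l * (τ ^ 2 * P) ≤ l ^ 2 * (τ ^ 2 * P) := by gcongr; nlinarith
          linarith
      _ ≤ l * τ ^ 2 * (|K| * (R ^ 2 * Real.exp (-R))) := by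
          refine mul_le_mul_of_nonneg_left (hvD.trans ?_) (by positivity)
          gcongr
          exact le_abs_self K
      _ ≤ 2 * τ ^ 2 * (|K| * (R ^ 2 * Real.exp (-R))) := by gcongr
      _ = _ := by rw [hτ]; ring
  linarith

theorem energy_tendsto_neg_infty
    (V : Plane → ℝ) (hV : V110 V) (Ω : ℝ) (hΩ : 0 ≤ Ω)
    (Q : Plane → ℝ) (hQ : IsGroundState Q)
    (astar : ℝ) (hastar : astar = ∫ x : Plane, (Q x) ^ 2) :
    ∀ M : ℝ, ∀ᶠ a in 𝓝[<] astar, ∃ u ∈ Sset V a, Ea V Ω u < M := by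
  intro M
  have hmass := hQ.mass_pos
  obtain ⟨w, hw, hc, hm, hlt⟩ := exists_energy_lt_at_critical_mass hV hQ M
  rw [← hastar] at hm hmass
  set A := ∫ x, (gradSqR w x + V x * w x ^ 2)
  set B := 1 / 2 * logConv (fun x => (w x : ℂ)) - 1 / 2 * ∫ x, w x ^ 4
  have hcont : Continuous fun a : ℝ => a / astar * A + (a / astar) ^ 2 * B := by fun_prop
  have hev : ∀ᶠ a in 𝓝 astar, a / astar * A + (a / astar) ^ 2 * B < M := by
    refine hcont.continuousAt.eventually_lt_const ?_
    simpa [div_self hmass.ne'] using hlt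
  filter_upwards [nhdsWithin_le_nhds hev, nhdsWithin_le_nhds (lt_mem_nhds hmass)] with a ha ha0
  have hs : √(a / astar) ^ 2 = a / astar := Real.sq_sqrt (by positivity)
  refine ⟨fun x => ((√(a / astar) * w x : ℝ) : ℂ), ?_, ?_⟩
  · have := mul_ofReal_mem_Sset hV hw hc (√(a / astar))
    rwa [hs, hm, div_mul_cancel₀ _ hmass.ne'] at this
  · rwa [Ea_mul_ofReal V Ω _ (hw.differentiable one_ne_zero), hs]

end
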